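/- In the PUM construction based on Gabidulin codes with dual memory m_H = 1: if c_1, c_2 ∈ F^n are not both zero and satisfy H_1·c_1^T + H_0·c_2^T = 0, then rank_q(c_1) + rank_q(c_2) ≥ n − k + 1. (This is because (H_1 | H_0) is the parity-check matrix of a (2n, 2n−(n−k)) Gabidulin code and the rank norm of the concatenation (c_1 | c_2) is at most rank_q(c_1) + rank_q(c_2).) -/

import Mathlib

open Matrix

/-- The rank norm of a vector `v ∈ F^n`. -/
noncomputable def rankq (Fq : Type*) {F : Type*} [Field Fq] [Field F] [Algebra Fq F]
    {n : ℕ} (v : Fin n → F) : ℕ :=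
  Module.finrank Fq (Submodule.span Fq (Set.range v))

/-- The `r × n` Moore (Frobenius) matrix `V_r(h)` with `(i,j)` entry `h_j^(q^i)`. -/
noncomputable def moore (q r : ℕ) {F : Type*} [Field F] {n : ℕ} (h : Fin n → F) :
    Matrix (Fin r) (Fin n) F :=
  Matrix.of fun i j => h j ^ q ^ (i : ℕ)

/-- Iterated Frobenius `x ↦ x^(q^i)` is linear over the field with `q` elements. -/
theorem exists_linearMap_pow_card_pow (K L : Type*) [Field K] [Fintype K] [Field L] [Algebra K L]
    (i : ℕ) : ∃ φ : L →ₗ[K] L, ∀ x, φ x = x ^ Fintype.card K ^ i := by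
  induction i with
  | zero => exact ⟨LinearMap.id, fun x => by simp⟩
  | succ i ih =>
    obtain ⟨φ, hφ⟩ := ih
    refine ⟨(FiniteField.frobeniusAlgHom K L).toLinearMap ∘ₗ φ, fun x => ?_⟩
    simp [hφ, pow_succ, pow_mul]

/-- A nontrivial combination of the first `t` Frobenius powers cannot vanish at `t` linearly
independent elements. -/
theorem eq_zero_of_sum_mul_pow_card_pow_eq_zero {K L : Type*} [Field K] [Fintype K] [Field L]
    [Algebra K L] {t : ℕ} {y w : Fin t → L} (hy : LinearIndependent K y)
    (hw : ∀ l, ∑ i, w i * y l ^ Fintype.card K ^ (i : ℕ) = 0) : w = 0 := by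
  classical
  have hq : 1 < Fintype.card K := Fintype.one_lt_card
  let p : Polynomial L := ∑ i : Fin t, Polynomial.monomial (Fintype.card K ^ (i : ℕ)) (w i)
  have hinj : Function.Injective fun a : Fin t → K => ∑ l, a l • y l := by
    intro a a' haa
    exact sub_eq_zero.mp (funext (Fintype.linearIndependent_iff.mp hy (a - a') (by
      simpa [sub_smul, sub_eq_zero] using haa)))
  have hp : p = 0 := by
    refine Polynomial.eq_zero_of_natDegree_lt_card_of_eval_eq_zero p hinj (fun a => ?_) ?_
    · have key : ∀ i : Fin t, (∑ l, a l • y l) ^ Fintype.card K ^ (i : ℕ) =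
          ∑ l, a l • y l ^ Fintype.card K ^ (i : ℕ) := fun i => by
        obtain ⟨φ, hφ⟩ := exists_linearMap_pow_card_pow K L i
        simp [← hφ]
      simp only [p, Polynomial.eval_finsetSum, Polynomial.eval_monomial, key, Finset.mul_sum,
        mul_smul_comm]
      rw [Finset.sum_comm]
      simp [← Finset.smul_sum, hw]
    · simp only [Fintype.card_pi, Finset.prod_const, Finset.card_univ, Fintype.card_fin]
      rw [← Nat.le_sub_one_iff_lt (by positivity)]
      refine Polynomial.natDegree_sum_le_of_forall_le _ _ fun i _ => ?_
      refine (Polynomial.natDegree_monomial_le _).trans (Nat.le_sub_one_of_lt ?_)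
      exact Nat.pow_lt_pow_right hq i.isLt
  funext j
  have hj := congrArg (fun f => Polynomial.coeff f (Fintype.card K ^ (j : ℕ))) hp
  simpa [p, Polynomial.finsetSum_coeff, Polynomial.coeff_monomial,
    (Nat.pow_right_injective hq).eq_iff, Fin.val_inj] using hj

/-- The square Moore matrix of linearly independent elements has trivial kernel. -/
theorem eq_zero_of_moore_mulVec_eq_zero {K L : Type*} [Field K] [Fintype K] [Field L]
    [Algebra K L] {t : ℕ} {y b : Fin t → L} (hy : LinearIndependent K y)
    (hb : (moore (Fintype.card K) t y).mulVec b = 0) : b = 0 := by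
  by_contra hne
  obtain ⟨w, hw0, hw⟩ := Matrix.exists_vecMul_eq_zero_iff.mpr
    (Matrix.exists_mulVec_eq_zero_iff.mp ⟨b, hne, hb⟩)
  exact hw0 (eq_zero_of_sum_mul_pow_card_pow_eq_zero hy fun l => congrFun hw l)

/-- The rank distance bound for Gabidulin codes: a nonzero vector in the kernel of the `r`-rowed
Moore matrix of linearly independent elements has rank norm larger than `r`. -/
theorem lt_finrank_span_of_sum_pow_card_pow_mul_eq_zero {K L ι : Type*} [Field K] [Fintype K]
    [Field L] [Algebra K L] [Fintype ι] {r : ℕ} {g c : ι → L} (hg : LinearIndependent K g)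
    (hc : c ≠ 0) (hsum : ∀ i < r, ∑ j, g j ^ Fintype.card K ^ i * c j = 0) :
    r < Module.finrank K (Submodule.span K (Set.range c)) := by
  by_contra! hle
  let S := Submodule.span K (Set.range c)
  have : FiniteDimensional K S := FiniteDimensional.span_of_finite K (Set.finite_range c)
  let b : Module.Basis (Fin (Module.finrank K S)) K S := Module.finBasis K S
  have hcS : ∀ j, c j ∈ S := fun j => Submodule.subset_span ⟨j, rfl⟩
  let a : ι → Fin (Module.finrank K S) → K := fun j l => b.repr ⟨c j, hcS j⟩ l
  have hca : ∀ j, c j = ∑ l, a j l • (b l : L) := fun j => by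
    have hsub := congrArg S.subtype (b.sum_repr ⟨c j, hcS j⟩)
    simp only [map_sum, map_smul] at hsub
    exact hsub.symm
  let y : Fin (Module.finrank K S) → L := fun l => ∑ j, a j l • g j
  have hy : LinearIndependent K y := by
    rw [Fintype.linearIndependent_iff]
    intro μ hμ
    have hμa : ∀ j, ∑ l, μ l * a j l = 0 := by
      refine Fintype.linearIndependent_iff.mp hg (fun j => ∑ l, μ l * a j l) ?_
      simp only [y, Finset.smul_sum, smul_smul] at hμ
      rw [Finset.sum_comm] at hμ
      simpa only [Finset.sum_smul] using hμ
    let f : S →ₗ[K] K := b.constr K μ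
    have hf : f = 0 := by
      refine LinearMap.ext_on_range (v := fun j => (⟨c j, hcS j⟩ : S)) ?_ fun j => ?_
      · convert Submodule.span_span_coe_preimage (R := K) (s := Set.range c) using 2
        ext x
        simp [Subtype.ext_iff]
      · simpa [f, a, Module.Basis.constr_apply_fintype, mul_comm] using hμa j
    intro l
    simpa [f] using LinearMap.congr_fun hf (b l)
  have hb : (fun l => (b l : L)) = 0 := by
    refine eq_zero_of_moore_mulVec_eq_zero hy (funext fun i => ?_)
    obtain ⟨φ, hφ⟩ := exists_linearMap_pow_card_pow K L i
    have hi := hsum i (i.isLt.trans_le hle)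
    simp only [hca, Finset.mul_sum] at hi
    rw [Finset.sum_comm] at hi
    simpa [moore, Matrix.mulVec, dotProduct, y, ← hφ, Finset.sum_mul] using hi
  refine hc (funext fun j => ?_)
  rw [hca j]
  exact Finset.sum_eq_zero fun l _ => by simp [show (b l : L) = 0 from congrFun hb l]

/-- In the PUM construction based on Gabidulin codes with `m_H = 1`: if `c₁, c₂` are
not both zero and `H_1 c₁ + H_0 c₂ = 0`, then `rank_q(c₁) + rank_q(c₂) ≥ n - k + 1`. -/
theorem pum_gabidulin_row_code_rank_bound
    (Fq F : Type*) [Field Fq] [Fintype Fq] [Field F] [Algebra Fq F]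
    [FiniteDimensional Fq F] (n k : ℕ) (hk : 1 ≤ k) (hkn : k < n)
    (h : Fin n → F)
    (hli : LinearIndependent Fq
      (Sum.elim h (fun j => h j ^ Fintype.card Fq ^ (n - k)) : Fin n ⊕ Fin n → F))
    (c₁ c₂ : Fin n → F) (hc : ¬(c₁ = 0 ∧ c₂ = 0))
    (hsyn : (moore (Fintype.card Fq) (n - k)
        (fun j => h j ^ Fintype.card Fq ^ (n - k))).mulVec c₁ +
      (moore (Fintype.card Fq) (n - k) h).mulVec c₂ = 0) :
    n - k + 1 ≤ rankq Fq c₁ + rankq Fq c₂ := by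
  have hne : Sum.elim c₁ c₂ ≠ 0 := fun h0 =>
    hc ⟨funext fun j => congrFun h0 (Sum.inl j), funext fun j => congrFun h0 (Sum.inr j)⟩
  have hli' := hli.comp Sum.swap (Equiv.sumComm (Fin n) (Fin n)).injective
  have hlt := lt_finrank_span_of_sum_pow_card_pow_mul_eq_zero (r := n - k) hli' hne fun i hi => by
    simpa [moore, Matrix.mulVec, dotProduct] using congrFun hsyn ⟨i, hi⟩
  rw [Set.Sum.elim_range, Submodule.span_union] at hlt
  exact hlt.trans_le (Submodule.finrank_add_le_finrank_add_finrank _ _)
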